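/- arXiv:2306.12504 — 2 statements merged into one kernel-verified Lean document; each statement's English description precedes it below -/
import Mathlib

section
/- Let α, β, γ be real numbers with 0 < γ ≤ 1 and 0 ≤ 2β|1−γ| < 2−γ, and suppose 0 < α < (1 − 1/γ)β + 1/γ − 1/2. Define K₁ = ((1−γ)/γ)(1 + 2α + α² − β − αβ) + (1/γ)(1 − α − α²) and K₂ = ((1−γ)/γ)(α² + β − αβ) + (1/γ)(α − α²). Then K₁ > K₂ > 0. -/
/-- Let `0 < γ ≤ 1`, `0 ≤ 2β|1−γ| < 2−γ` and
`0 < α < (1 − 1/γ)β + 1/γ − 1/2`. With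
`K₁ = ((1−γ)/γ)(1 + 2α + α² − β − αβ) + (1/γ)(1 − α − α²)` and
`K₂ = ((1−γ)/γ)(α² + β − αβ) + (1/γ)(α − α²)` it holds that `K₁ > K₂ > 0`. -/
theorem stmt_10 (α β γ : ℝ) (hγ0 : 0 < γ) (hγ1 : γ ≤ 1)
    (hβ0 : 0 ≤ 2 * β * |1 - γ|) (hβ : 2 * β * |1 - γ| < 2 - γ)
    (hα0 : 0 < α) (hα : α < (1 - 1 / γ) * β + 1 / γ - 1 / 2) :
    ((1 - γ) / γ) * (1 + 2 * α + α ^ 2 - β - α * β) + (1 / γ) * (1 - α - α ^ 2) >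
        ((1 - γ) / γ) * (α ^ 2 + β - α * β) + (1 / γ) * (α - α ^ 2) ∧
      ((1 - γ) / γ) * (α ^ 2 + β - α * β) + (1 / γ) * (α - α ^ 2) > 0 := by
  rw [abs_of_nonneg (sub_nonneg.2 hγ1)] at hβ0
  have hb : 0 ≤ β * (1 - γ) := by linarith
  have hα' : 0 < 2 - γ - 2 * (β * (1 - γ)) - 2 * (α * γ) := by
    have h := mul_pos (sub_pos.2 hα) hγ0
    have e : ((1 - 1 / γ) * β + 1 / γ - 1 / 2 - α) * γ =
        (2 - γ - 2 * (β * (1 - γ)) - 2 * (α * γ)) / 2 := by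
      field_simp
      ring
    linarith
  constructor
  · rw [gt_iff_lt, ← sub_pos]
    have e : ((1 - γ) / γ) * (1 + 2 * α + α ^ 2 - β - α * β) + (1 / γ) * (1 - α - α ^ 2) -
        (((1 - γ) / γ) * (α ^ 2 + β - α * β) + (1 / γ) * (α - α ^ 2)) =
        (2 - γ - 2 * (β * (1 - γ)) - 2 * (α * γ)) / γ := by
      field_simp
      ring
    rw [e]
    exact div_pos hα' hγ0
  · have e : ((1 - γ) / γ) * (α ^ 2 + β - α * β) + (1 / γ) * (α - α ^ 2) =
        (α * (1 - α * γ - β * (1 - γ)) + β * (1 - γ)) / γ := by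
      field_simp
      ring
    have h : 0 < 1 - α * γ - β * (1 - γ) := by linarith
    rw [e]
    exact div_pos (add_pos_of_pos_of_nonneg (mul_pos hα0 h) hb) hγ0
end

section
/- Let α, β, γ be real numbers with 1 < γ < 2 and 0 ≤ 2β|1−γ| < 2−γ, and suppose 0 < α < 1/(2β(γ−1)+γ) − 1/2. Define K₁ = ((1−γ)/γ)(1 + 2α + α² + β + αβ) + (1/γ)(1 − α − α²) and K₂ = ((1−γ)/γ)(α² − β − 3αβ) + (1/γ)(α − α²). Then K₁ > K₂ > 0. -/
/-- Let `1 < γ < 2`, `0 ≤ 2β|1−γ| < 2−γ` and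
`0 < α < 1/(2β(γ−1)+γ) − 1/2`. With
`K₁ = ((1−γ)/γ)(1 + 2α + α² + β + αβ) + (1/γ)(1 − α − α²)` and
`K₂ = ((1−γ)/γ)(α² − β − 3αβ) + (1/γ)(α − α²)` it holds that `K₁ > K₂ > 0`. -/
theorem stmt_11 (α β γ : ℝ) (hγ1 : 1 < γ) (hγ2 : γ < 2)
    (hβ0 : 0 ≤ 2 * β * |1 - γ|) (hβ : 2 * β * |1 - γ| < 2 - γ)
    (hα0 : 0 < α) (hα : α < 1 / (2 * β * (γ - 1) + γ) - 1 / 2) :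
    ((1 - γ) / γ) * (1 + 2 * α + α ^ 2 + β + α * β) + (1 / γ) * (1 - α - α ^ 2) >
        ((1 - γ) / γ) * (α ^ 2 - β - 3 * α * β) + (1 / γ) * (α - α ^ 2) ∧
      ((1 - γ) / γ) * (α ^ 2 - β - 3 * α * β) + (1 / γ) * (α - α ^ 2) > 0 := by
  have habs : |1 - γ| = γ - 1 := by rw [abs_sub_comm, abs_of_pos (by linarith)]
  rw [habs] at hβ0
  have hγ : 0 < γ := by linarith
  have hden : 0 < 2 * β * (γ - 1) + γ := by linarith
  have hprod : (α + 1 / 2) * (2 * β * (γ - 1) + γ) < 1 :=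
    (lt_div_iff₀ hden).mp (by linarith)
  have hαγ : 0 < 1 - α * γ := by nlinarith [mul_nonneg hα0.le hβ0]
  constructor
  · rw [gt_iff_lt, ← sub_pos]
    have hdiff : ((1 - γ) / γ) * (1 + 2 * α + α ^ 2 + β + α * β) + (1 / γ) * (1 - α - α ^ 2) -
        (((1 - γ) / γ) * (α ^ 2 - β - 3 * α * β) + (1 / γ) * (α - α ^ 2)) =
        2 * (1 - (α + 1 / 2) * (2 * β * (γ - 1) + γ)) / γ := by
      field_simp
      ring
    rw [hdiff]
    exact div_pos (by linarith) hγ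
  · have hK₂ : ((1 - γ) / γ) * (α ^ 2 - β - 3 * α * β) + (1 / γ) * (α - α ^ 2) =
        ((2 * β * (γ - 1)) * (1 + 3 * α) / 2 + α * (1 - α * γ)) / γ := by
      field_simp
      ring
    rw [hK₂]
    positivity
end
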